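/- arXiv:0712.1414 — 2 statements merged into one kernel-verified Lean document; each statement's English description precedes it below -/
import Mathlib

section
/- For almost every θ ∈ [0,1], the function F(s,θ) = ∑_{n=2}^∞ Λ(n) e^{2πiθn} n^{-s} extends to an analytic function on the half-plane Re s > 1/2. -/
open MeasureTheory

open Filter Topology
open scoped ArithmeticFunction.vonMangoldt

/-- The exponential sum `∑_{n < N} a n e^{2πiθn}`. -/
noncomputable def expSum (a : ℕ → ℝ) (N : ℕ) (θ : ℝ) : ℂ :=
  ∑ n ∈ Finset.range N, (a n : ℂ) * Complex.exp (2 * Real.pi * Complex.I * θ * n)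

lemma continuous_expSum (a : ℕ → ℝ) (N : ℕ) : Continuous (expSum a N) := by
  unfold expSum
  fun_prop

lemma integral_exp_two_pi_mul_I_mul_int (k : ℤ) :
    ∫ θ in (0 : ℝ)..1, Complex.exp (2 * Real.pi * Complex.I * k * θ) = if k = 0 then 1 else 0 := by
  split_ifs with hk
  · simp [hk]
  · have hc : (2 * Real.pi * Complex.I * k : ℂ) ≠ 0 := by
      simp [hk, Real.pi_ne_zero]
    rw [integral_exp_mul_complex hc]
    have : (2 * Real.pi * Complex.I * k : ℂ) = k * (2 * Real.pi * Complex.I) := by ring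
    simp [this, Complex.exp_int_mul_two_pi_mul_I]

lemma norm_exp_two_pi_mul_I (θ : ℝ) (n : ℕ) :
    ‖Complex.exp (2 * Real.pi * Complex.I * θ * n)‖ = 1 := by
  rw [Complex.norm_exp]
  simp

lemma normSq_expSum (a : ℕ → ℝ) (N : ℕ) (θ : ℝ) :
    ((‖expSum a N θ‖ ^ 2 : ℝ) : ℂ) = ∑ m ∈ Finset.range N, ∑ n ∈ Finset.range N,
      ((a m * a n : ℝ) : ℂ) *
        Complex.exp (2 * Real.pi * Complex.I * ((m - n : ℤ) : ℂ) * θ) := by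
  rw [Complex.ofReal_pow, ← Complex.mul_conj', expSum, map_sum, Finset.sum_mul_sum]
  refine Finset.sum_congr rfl fun m _ => Finset.sum_congr rfl fun n _ => ?_
  rw [map_mul, ← Complex.exp_conj, mul_mul_mul_comm, ← Complex.exp_add]
  simp only [map_mul, Complex.conj_ofReal, Complex.conj_I, map_natCast, map_ofNat]
  push_cast
  congr 2
  ring

/-- Parseval's identity for exponential sums. -/
lemma integral_normSq_expSum (a : ℕ → ℝ) (N : ℕ) :
    ∫ θ in (0 : ℝ)..1, ‖expSum a N θ‖ ^ 2 = ∑ n ∈ Finset.range N, a n ^ 2 := by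
  have hint (c : ℂ) (k : ℤ) : IntervalIntegrable
      (fun θ : ℝ => c * Complex.exp (2 * Real.pi * Complex.I * k * θ)) volume 0 1 :=
    Continuous.intervalIntegrable (by fun_prop) _ _
  apply Complex.ofReal_injective
  rw [← intervalIntegral.integral_ofReal]
  simp_rw [normSq_expSum]
  rw [intervalIntegral.integral_finsetSum fun m _ =>
    Continuous.intervalIntegrable (by fun_prop) _ _]
  push_cast
  refine Finset.sum_congr rfl fun m hm => ?_
  rw [intervalIntegral.integral_finsetSum fun n _ => by simpa using hint (a m * a n) (m - n)]
  rw [Finset.sum_eq_single m]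
  · simp [sq]
  · intro n _ hn
    have := integral_exp_two_pi_mul_I_mul_int (m - n)
    rw [if_neg (by omega)] at this
    push_cast at this
    rw [intervalIntegral.integral_const_mul, this, mul_zero]
  · exact fun h => absurd hm h

lemma integral_norm_expSum_le (a : ℕ → ℝ) (N : ℕ) {c : ℝ} (hc : 0 < c) :
    ∫ θ in (0 : ℝ)..1, ‖expSum a N θ‖ ≤ c + c⁻¹ * ∑ n ∈ Finset.range N, a n ^ 2 := by
  have hcont := continuous_expSum a N
  calc ∫ θ in (0 : ℝ)..1, ‖expSum a N θ‖
      ≤ ∫ θ in (0 : ℝ)..1, (c + c⁻¹ * ‖expSum a N θ‖ ^ 2) := by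
        refine intervalIntegral.integral_mono zero_le_one
          (Continuous.intervalIntegrable (by fun_prop) _ _)
          (Continuous.intervalIntegrable (by fun_prop) _ _) fun θ => ?_
        have h : c⁻¹ * (‖expSum a N θ‖ - c) ^ 2 + ‖expSum a N θ‖
            = c + c⁻¹ * ‖expSum a N θ‖ ^ 2 - ‖expSum a N θ‖ := by
          field_simp
          ring
        have h0 : 0 ≤ c⁻¹ * (‖expSum a N θ‖ - c) ^ 2 := by positivity
        have h1 := norm_nonneg (expSum a N θ)
        linarith
    _ = _ := by
        rw [intervalIntegral.integral_add (by simp)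
          (Continuous.intervalIntegrable (by fun_prop) _ _), intervalIntegral.integral_const_mul,
          integral_normSq_expSum]
        simp

lemma sum_vonMangoldt_sq_le {ε : ℝ} (hε : 0 < ε) {i : ℕ} (hi : 1 ≤ i) :
    ∑ n ∈ Finset.range (i + 1), Λ n ^ 2 ≤ 2 / ε ^ 2 * (i : ℝ) ^ (1 + 2 * ε) := by
  have hi' : (1 : ℝ) ≤ i := by exact_mod_cast hi
  have hterm : ∀ n ∈ Finset.range (i + 1), Λ n ^ 2 ≤ ((i : ℝ) ^ ε / ε) ^ 2 := by
    intro n hn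
    have hn' : (n : ℝ) ≤ i := by exact_mod_cast Nat.lt_succ_iff.mp (Finset.mem_range.mp hn)
    refine pow_le_pow_left₀ ArithmeticFunction.vonMangoldt_nonneg ?_ 2
    calc Λ n ≤ Real.log n := ArithmeticFunction.vonMangoldt_le_log
      _ ≤ (n : ℝ) ^ ε / ε := Real.log_le_rpow_div (by positivity) hε
      _ ≤ (i : ℝ) ^ ε / ε := by gcongr
  have hpow : (i : ℝ) ^ (1 + 2 * ε) = i * ((i : ℝ) ^ ε) ^ 2 := by
    rw [Real.rpow_add (by positivity), Real.rpow_one, mul_comm 2 ε, Real.rpow_mul (by positivity)]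
    norm_num
  calc ∑ n ∈ Finset.range (i + 1), Λ n ^ 2
      ≤ ∑ _n ∈ Finset.range (i + 1), ((i : ℝ) ^ ε / ε) ^ 2 := Finset.sum_le_sum hterm
    _ = (i + 1) * ((i : ℝ) ^ ε / ε) ^ 2 := by simp
    _ ≤ (2 * i) * ((i : ℝ) ^ ε / ε) ^ 2 := by gcongr; linarith
    _ = _ := by rw [hpow]; ring

lemma integral_norm_expSum_vonMangoldt_le {ε : ℝ} (hε : 0 < ε) {i : ℕ} (hi : 1 ≤ i) :
    ∫ θ in (0 : ℝ)..1, ‖expSum Λ (i + 1) θ‖ ≤ (1 + 2 / ε ^ 2) * (i : ℝ) ^ (1 / 2 + ε) := by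
  have hi' : (0 : ℝ) < i := by exact_mod_cast hi
  refine (integral_norm_expSum_le Λ (i + 1)
    (Real.rpow_pos_of_pos hi' (1 / 2 + ε))).trans ?_
  grw [sum_vonMangoldt_sq_le hε hi]
  rw [add_mul, one_mul, mul_left_comm, ← Real.rpow_neg hi'.le, ← Real.rpow_add hi']
  ring_nf
  rfl

lemma ae_summable_norm_expSum_vonMangoldt {δ : ℝ} (hδ : 0 < δ) :
    ∀ᵐ θ : ℝ ∂(volume.restrict (Set.Icc (0 : ℝ) 1)),
      Summable fun i : ℕ => ‖expSum Λ (i + 1) θ‖ * (i : ℝ) ^ (-(1 / 2 + δ) - 1) := by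
  set w : ℕ → ℝ := fun i => (i : ℝ) ^ (-(1 / 2 + δ) - 1) with hw
  have hw0 (i : ℕ) : 0 ≤ w i := by positivity
  have hcont (i : ℕ) : Continuous fun θ => ‖expSum Λ (i + 1) θ‖ * w i :=
    (continuous_expSum _ _).norm.mul_const _
  have hint (i : ℕ) : Integrable (fun θ => ‖expSum Λ (i + 1) θ‖ * w i)
      (volume.restrict (Set.Icc (0 : ℝ) 1)) :=
    (hcont i).continuousOn.integrableOn_Icc
  set C : ℝ := 1 + 2 / (δ / 2) ^ 2
  have hbound (i : ℕ) : ∫ θ in Set.Icc (0 : ℝ) 1, ‖expSum Λ (i + 1) θ‖ * w i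
      ≤ C * (i : ℝ) ^ (-(1 + δ / 2)) := by
    rw [integral_Icc_eq_integral_Ioc, ← intervalIntegral.integral_of_le zero_le_one,
      intervalIntegral.integral_mul_const]
    rcases Nat.eq_zero_or_pos i with rfl | hi
    · simp only [hw]
      rw [Nat.cast_zero, Real.zero_rpow (by linarith), Real.zero_rpow (by linarith)]
      simp
    · grw [integral_norm_expSum_vonMangoldt_le (half_pos hδ) hi]
      · rw [mul_assoc, ← Real.rpow_add (by exact_mod_cast hi)]
        exact le_of_eq (by congr 2; ring)
  have hsum : Summable fun i : ℕ => C * (i : ℝ) ^ (-(1 + δ / 2)) :=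
    (Real.summable_nat_rpow.mpr (by linarith)).mul_left C
  have := summable_norm_of_tsum_eLpNorm_ne_top (μ := volume.restrict (Set.Icc (0 : ℝ) 1))
    le_rfl (f := fun i θ => ‖expSum Λ (i + 1) θ‖ * w i) (fun i => (hint i).aestronglyMeasurable) ?_
  · filter_upwards [this] with θ hθ
    exact hθ.congr fun i => Real.norm_of_nonneg (mul_nonneg (norm_nonneg _) (hw0 i))
  · refine ne_top_of_le_ne_top hsum.tsum_ofReal_ne_top (ENNReal.tsum_le_tsum fun i => ?_)
    rw [eLpNorm_one_eq_lintegral_enorm, ← ofReal_integral_norm_eq_lintegral_enorm (hint i)]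
    refine ENNReal.ofReal_le_ofReal (le_trans (le_of_eq ?_) (hbound i))
    refine integral_congr_ae (Eventually.of_forall fun θ => ?_)
    exact Real.norm_of_nonneg (mul_nonneg (norm_nonneg _) (hw0 i))

lemma norm_cpow_neg_sub_cpow_neg_le {s : ℂ} (hs : 0 < s.re) {i : ℕ} (hi : 1 ≤ i) :
    ‖(i : ℂ) ^ (-s) - ((i + 1 : ℕ) : ℂ) ^ (-s)‖ ≤ ‖s‖ * (i : ℝ) ^ (-s.re - 1) := by
  have hi' : (0 : ℝ) < i := by exact_mod_cast hi
  have hs0 : -s ≠ 0 := by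
    rintro h
    simp [neg_eq_zero.mp h] at hs
  have key := Convex.norm_image_sub_le_of_norm_hasDerivWithin_le
    (f := fun y : ℝ => (y : ℂ) ^ (-s)) (f' := fun y : ℝ => -s * (y : ℂ) ^ (-s - 1))
    (s := Set.Icc (i : ℝ) (i + 1)) (x := i + 1) (y := i) (C := ‖s‖ * (i : ℝ) ^ (-s.re - 1))
    (fun x hx => (hasDerivAt_ofReal_cpow_const (hi'.trans_le hx.1).ne' hs0).hasDerivWithinAt)
    (fun x hx => ?_) (convex_Icc _ _) (by simp) (by simp)
  · simpa using key
  · rw [norm_mul, norm_neg, Complex.norm_cpow_eq_rpow_re_of_pos (hi'.trans_le hx.1)]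
    simp only [Complex.sub_re, Complex.neg_re, Complex.one_re]
    exact mul_le_mul_of_nonneg_left
      (Real.rpow_le_rpow_of_nonpos hi' hx.1 (by linarith)) (norm_nonneg s)

/-- The `i`-th term of the series obtained from `∑ Λ(n) e^{2πiθn} n^{-s}` by partial summation. -/
noncomputable def abelTerm (θ : ℝ) (i : ℕ) (s : ℂ) : ℂ :=
  expSum Λ (i + 1) θ * ((i : ℂ) ^ (-s) - ((i + 1 : ℕ) : ℂ) ^ (-s))

lemma abelTerm_zero (θ : ℝ) (s : ℂ) : abelTerm θ 0 s = 0 := by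
  simp [abelTerm, expSum]

lemma differentiable_abelTerm (θ : ℝ) (i : ℕ) : Differentiable ℂ (abelTerm θ i) := by
  rcases Nat.eq_zero_or_pos i with rfl | hi
  · rw [show abelTerm θ 0 = fun _ => 0 from funext (abelTerm_zero θ)]
    exact differentiable_const 0
  · have hi' : (i : ℂ) ≠ 0 := by exact_mod_cast hi.ne'
    have hi'' : ((i + 1 : ℕ) : ℂ) ≠ 0 := by exact_mod_cast i.succ_ne_zero
    unfold abelTerm
    exact ((differentiable_id.neg.const_cpow (Or.inl hi')).sub
      (differentiable_id.neg.const_cpow (Or.inl hi''))).const_mul _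

lemma norm_abelTerm_le (θ : ℝ) (i : ℕ) {σ : ℝ} (hσ : 0 < σ) {s : ℂ} (hs : σ ≤ s.re) :
    ‖abelTerm θ i s‖ ≤ ‖s‖ * (‖expSum Λ (i + 1) θ‖ * (i : ℝ) ^ (-σ - 1)) := by
  rcases Nat.eq_zero_or_pos i with rfl | hi
  · rw [abelTerm_zero, norm_zero]
    positivity
  · rw [abelTerm, norm_mul, mul_left_comm]
    grw [norm_cpow_neg_sub_cpow_neg_le (hσ.trans_le hs) hi]
    gcongr
    exact_mod_cast hi

lemma sum_range_succ_eq_abel (θ : ℝ) (s : ℂ) (M : ℕ) :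
    ∑ n ∈ Finset.range (M + 1), (Λ n : ℂ) * Complex.exp (2 * Real.pi * Complex.I * θ * n) *
        (n : ℂ) ^ (-s) =
      expSum Λ (M + 1) θ * (M : ℂ) ^ (-s) + ∑ i ∈ Finset.range M, abelTerm θ i s := by
  induction M with
  | zero => simp [expSum]
  | succ M ih =>
    rw [Finset.sum_range_succ, ih, Finset.sum_range_succ _ M, abelTerm, expSum, expSum,
      Finset.sum_range_succ _ (M + 1)]
    ring

lemma norm_expSum_vonMangoldt_le (M : ℕ) (θ : ℝ) :
    ‖expSum Λ (M + 1) θ‖ ≤ (Real.log 4 + 4) * M := by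
  calc ‖expSum Λ (M + 1) θ‖ ≤ ∑ n ∈ Finset.range (M + 1), Λ n := by
        refine norm_sum_le_of_le _ fun n _ => ?_
        rw [norm_mul, norm_exp_two_pi_mul_I, mul_one, Complex.norm_real, Real.norm_of_nonneg
          ArithmeticFunction.vonMangoldt_nonneg]
    _ = Chebyshev.psi M := by
        rw [Chebyshev.psi_eq_sum_Icc, Nat.floor_natCast, Finset.range_eq_Ico]
        rfl
    _ ≤ _ := Chebyshev.psi_le_const_mul_self (by positivity)

lemma tendsto_expSum_mul_cpow (θ : ℝ) {s : ℂ} (hs : 1 < s.re) :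
    Tendsto (fun M : ℕ => expSum Λ (M + 1) θ * (M : ℂ) ^ (-s)) atTop (𝓝 0) := by
  have hlim : Tendsto (fun M : ℕ => (Real.log 4 + 4) * (M : ℝ) ^ (-(s.re - 1))) atTop (𝓝 0) := by
    simpa using ((tendsto_rpow_neg_atTop (sub_pos.mpr hs)).comp
      tendsto_natCast_atTop_atTop).const_mul (Real.log 4 + 4)
  refine squeeze_zero_norm' ?_ hlim
  filter_upwards [eventually_ge_atTop 1] with M hM
  have hM' : (0 : ℝ) < M := by exact_mod_cast hM
  rw [norm_mul, Complex.norm_natCast_cpow_of_pos hM]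
  grw [norm_expSum_vonMangoldt_le]
  rw [mul_assoc, Complex.neg_re, ← Real.rpow_one_add' hM'.le (by linarith)]
  ring_nf
  rfl

lemma summable_vonMangoldt_mul_exp_mul_cpow (θ : ℝ) {s : ℂ} (hs : 1 < s.re) :
    Summable fun n : ℕ => (Λ n : ℂ) * Complex.exp (2 * Real.pi * Complex.I * θ * n) *
      (n : ℂ) ^ (-s) := by
  refine Summable.of_norm_bounded (ArithmeticFunction.LSeriesSummable_vonMangoldt hs).norm
    fun n => ?_
  rcases eq_or_ne n 0 with rfl | hn
  · simp
  · rw [LSeries.term_of_ne_zero hn, norm_mul, norm_mul, norm_exp_two_pi_mul_I, mul_one, norm_div,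
      Complex.cpow_neg, norm_inv, div_eq_mul_inv]

/-- For almost every `θ ∈ [0,1]`, `F(s,θ) = ∑_{n≥2} Λ(n) e^{2πiθn} n^{-s}`
extends to an analytic function on `Re s > 1/2` (agreeing with the series where
it converges absolutely, i.e. on `Re s > 1`; the terms `n = 0, 1` vanish). -/
theorem stmt_14 :
    ∀ᵐ θ : ℝ ∂(volume.restrict (Set.Icc (0:ℝ) 1)),
      ∃ F : ℂ → ℂ, AnalyticOn ℂ F {s : ℂ | 1 / 2 < s.re} ∧
        ∀ s : ℂ, 1 < s.re →
          F s = ∑' n : ℕ, ((ArithmeticFunction.vonMangoldt n : ℝ) : ℂ) *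
            Complex.exp (2 * Real.pi * Complex.I * θ * n) * (n : ℂ) ^ (-s) := by
  have hae : ∀ᵐ θ : ℝ ∂(volume.restrict (Set.Icc (0 : ℝ) 1)), ∀ k : ℕ,
      Summable fun i : ℕ =>
        ‖expSum Λ (i + 1) θ‖ * (i : ℝ) ^ (-(1 / 2 + 1 / ((k : ℝ) + 1)) - 1) :=
    ae_all_iff.mpr fun k => ae_summable_norm_expSum_vonMangoldt Nat.one_div_pos_of_nat
  filter_upwards [hae] with θ hθ
  refine ⟨fun s => ∑' i, abelTerm θ i s, ?_, fun s hs => ?_⟩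
  · refine DifferentiableOn.analyticOn (fun s hs => ?_)
      (isOpen_lt continuous_const Complex.continuous_re)
    obtain ⟨k, hk⟩ := exists_nat_one_div_lt (sub_pos.mpr (show 1 / 2 < s.re from hs))
    set U : Set ℂ := {z | 1 / 2 + 1 / ((k : ℝ) + 1) < z.re} ∩ Metric.ball 0 (‖s‖ + 1)
    have hU : IsOpen U :=
      (isOpen_lt continuous_const Complex.continuous_re).inter Metric.isOpen_ball
    have hdiff : DifferentiableOn ℂ (fun z => ∑' i, abelTerm θ i z) U := by
      refine Complex.differentiableOn_tsum_of_summable_norm ((hθ k).mul_left (‖s‖ + 1))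
        (fun i => (differentiable_abelTerm θ i).differentiableOn) hU fun i z hz => ?_
      refine (norm_abelTerm_le θ i (by positivity) (le_of_lt hz.1)).trans ?_
      gcongr
      exact (mem_ball_zero_iff.mp hz.2).le
    have hsU : s ∈ U := ⟨by change _ < s.re; linarith, by simp⟩
    exact (hdiff.differentiableAt (hU.mem_nhds hsU)).differentiableWithinAt
  · have hsum : Summable fun i => abelTerm θ i s := by
      refine Summable.of_norm_bounded ((hθ 1).mul_left ‖s‖) fun i => ?_
      exact norm_abelTerm_le θ i (by positivity) (by norm_num; exact hs.le)
    have h1 := (tendsto_expSum_mul_cpow θ hs).add hsum.hasSum.tendsto_sum_nat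
    simp_rw [← sum_range_succ_eq_abel, zero_add] at h1
    exact tendsto_nhds_unique h1 ((tendsto_add_atTop_iff_nat 1).mpr
      (summable_vonMangoldt_mul_exp_mul_cpow θ hs).hasSum.tendsto_sum_nat)
end

section
/- For almost every θ ∈ [0,1], the function f(s,θ) = ∏_p (1 − e^{2πiθp} p^{-s})^{-1}, initially defined for Re s > 1, has an analytic continuation to the half-plane Re s > 1/2 on which it never vanishes. -/
open MeasureTheory
open Filter Topology

lemma norm_natCast_cpow_neg_sub_le (n : ℕ) {s : ℂ} (hs : 0 < s.re) :
    ‖((n + 1 : ℕ) : ℂ) ^ (-s) - ((n + 2 : ℕ) : ℂ) ^ (-s)‖ ≤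
      ‖s‖ * ((n + 1 : ℕ) : ℝ) ^ (-s.re - 1) := by
  have hs0 : -s ≠ 0 := by
    rintro h
    rw [neg_eq_zero] at h
    simp [h] at hs
  have hpos : ∀ x ∈ Set.Icc ((n + 1 : ℕ) : ℝ) ((n + 2 : ℕ) : ℝ), 0 < x := fun x hx ↦
    lt_of_lt_of_le (by positivity) hx.1
  have h := Convex.norm_image_sub_le_of_norm_hasDerivWithin_le (𝕜 := ℝ)
    (f := fun x : ℝ ↦ (x : ℂ) ^ (-s)) (f' := fun x : ℝ ↦ -s * (x : ℂ) ^ (-s - 1))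
    (s := Set.Icc ((n + 1 : ℕ) : ℝ) ((n + 2 : ℕ) : ℝ))
    (x := ((n + 1 : ℕ) : ℝ)) (y := ((n + 2 : ℕ) : ℝ))
    (C := ‖s‖ * ((n + 1 : ℕ) : ℝ) ^ (-s.re - 1))
    (fun x hx ↦ (hasDerivAt_ofReal_cpow_const (hpos x hx).ne' hs0).hasDerivWithinAt)
    (fun x hx ↦ by
      rw [norm_mul, norm_neg, Complex.norm_cpow_eq_rpow_re_of_pos (hpos x hx)]
      gcongr ?_ * ?_
      simpa using Real.rpow_le_rpow_of_nonpos (z := -s.re - 1) (by positivity) hx.1 (by linarith))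
    (convex_Icc _ _) (by simp) (by simp)
  rw [norm_sub_rev]
  have h1 : ‖((n + 2 : ℕ) : ℝ) - ((n + 1 : ℕ) : ℝ)‖ = 1 := by
    push_cast
    norm_num
  rw [h1, mul_one] at h
  simpa using h

/-- Abel summation turns a Dirichlet series with bounded coefficients into a series over the
partial sums of its coefficients. -/
lemma tsum_mul_cpow_eq_tsum_partialSums {b : ℕ → ℂ} (hb : ∀ i, ‖b i‖ ≤ 1) {s : ℂ} (hs : 1 < s.re)
    (hsum : Summable fun i : ℕ ↦ (∑ j ∈ Finset.range (i + 1), b j) *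
      (((i + 1 : ℕ) : ℂ) ^ (-s) - ((i + 2 : ℕ) : ℂ) ^ (-s))) :
    ∑' i : ℕ, b i * ((i + 1 : ℕ) : ℂ) ^ (-s) = ∑' i : ℕ, (∑ j ∈ Finset.range (i + 1), b j) *
      (((i + 1 : ℕ) : ℂ) ^ (-s) - ((i + 2 : ℕ) : ℂ) ^ (-s)) := by
  have hnorm (i : ℕ) : ‖((i + 1 : ℕ) : ℂ) ^ (-s)‖ = ((i + 1 : ℕ) : ℝ) ^ (-s.re) := by
    rw [Complex.norm_natCast_cpow_of_pos i.succ_pos, Complex.neg_re]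
  have hs1 : Summable fun i : ℕ ↦ b i * ((i + 1 : ℕ) : ℂ) ^ (-s) := by
    refine Summable.of_norm_bounded
      ((summable_nat_add_iff 1).2 (Real.summable_nat_rpow.2 (by linarith : -s.re < -1))) fun i ↦ ?_
    rw [norm_mul, hnorm]
    exact mul_le_of_le_one_left (by positivity) (hb i)
  have hlim : Tendsto (fun n : ℕ ↦ ((n + 1 : ℕ) : ℂ) ^ (-s) * ∑ j ∈ Finset.range (n + 1), b j)
      atTop (𝓝 0) := by
    have h0 : Tendsto (fun n : ℕ ↦ ((n + 1 : ℕ) : ℝ) ^ (-(s.re - 1))) atTop (𝓝 0) :=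
      ((tendsto_rpow_neg_atTop (by linarith : 0 < s.re - 1)).comp
        tendsto_natCast_atTop_atTop).comp (tendsto_add_atTop_nat 1)
    refine squeeze_zero_norm (fun n ↦ ?_) h0
    rw [norm_mul, hnorm]
    have hG : ‖∑ j ∈ Finset.range (n + 1), b j‖ ≤ ((n + 1 : ℕ) : ℝ) := by
      simpa using norm_sum_le_of_le (Finset.range (n + 1)) fun j _ ↦ hb j
    calc _ ≤ ((n + 1 : ℕ) : ℝ) ^ (-s.re) * ((n + 1 : ℕ) : ℝ) := by gcongr
      _ = _ := by
        rw [← Real.rpow_add_one (by positivity)]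
        congr 1
        ring
  have hparts (n : ℕ) : ∑ i ∈ Finset.range (n + 1), b i * ((i + 1 : ℕ) : ℂ) ^ (-s) =
      ((n + 1 : ℕ) : ℂ) ^ (-s) * ∑ j ∈ Finset.range (n + 1), b j +
      ∑ i ∈ Finset.range n, (∑ j ∈ Finset.range (i + 1), b j) *
      (((i + 1 : ℕ) : ℂ) ^ (-s) - ((i + 2 : ℕ) : ℂ) ^ (-s)) := by
    have := Finset.sum_range_by_parts (fun i : ℕ ↦ ((i + 1 : ℕ) : ℂ) ^ (-s)) b (n + 1)
    simp only [smul_eq_mul, Nat.add_sub_cancel] at this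
    rw [Finset.sum_congr rfl fun i _ ↦ mul_comm (b i) _, this, sub_eq_add_neg,
      ← Finset.sum_neg_distrib]
    congr 1
    refine Finset.sum_congr rfl fun i _ ↦ ?_
    rw [add_assoc, one_add_one_eq_two]
    ring
  have h1 := (hs1.hasSum.tendsto_sum_nat).comp (tendsto_add_atTop_nat 1)
  have h2 := hlim.add hsum.hasSum.tendsto_sum_nat
  rw [zero_add] at h2
  exact tendsto_nhds_unique h1 (h2.congr fun n ↦ (hparts n).symm)

/-- A function differentiable on every bounded piece of a smaller half-plane is differentiable
on the half-plane. -/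
lemma differentiableOn_half_lt_re {f : ℂ → ℂ}
    (h : ∀ σ : ℝ, 1 / 2 < σ → ∀ R : ℝ, DifferentiableOn ℂ f {s : ℂ | σ < s.re ∧ ‖s‖ < R}) :
    DifferentiableOn ℂ f {s : ℂ | 1 / 2 < s.re} := by
  intro s hs
  obtain ⟨σ, hσ, hσs⟩ := exists_between (show (1 / 2 : ℝ) < s.re from hs)
  refine ((h σ hσ (‖s‖ + 1)).differentiableAt ?_).differentiableWithinAt
  exact ((isOpen_lt continuous_const Complex.continuous_re).inter
    (isOpen_lt continuous_norm continuous_const)).mem_nhds ⟨hσs, by simp⟩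

/-- Square-mean control of the partial sums bounds the terms of the summed-by-parts series. -/
lemma norm_mul_cpow_sub_le {σ : ℝ} (hσ : 1 / 2 < σ) (G : ℂ) {R : ℝ} (n : ℕ) {s : ℂ}
    (hs : σ < s.re) (hR : ‖s‖ < R) :
    ‖G * (((n + 1 : ℕ) : ℂ) ^ (-s) - ((n + 2 : ℕ) : ℂ) ^ (-s))‖ ≤
      R * (‖G‖ ^ 2 * ((n + 1 : ℕ) : ℝ) ^ (-σ - 3 / 2) + ((n + 1 : ℕ) : ℝ) ^ (-σ - 1 / 2)) := by
  have hR0 : 0 ≤ R := (norm_nonneg s).trans hR.le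
  have hn : (0 : ℝ) < ((n + 1 : ℕ) : ℝ) := by positivity
  have hn1 : (1 : ℝ) ≤ ((n + 1 : ℕ) : ℝ) := by simp
  have e1 : ((n + 1 : ℕ) : ℝ) ^ (-σ - 1) =
      ((n + 1 : ℕ) : ℝ) ^ ((-σ - 3 / 2) / 2) * ((n + 1 : ℕ) : ℝ) ^ ((-σ - 1 / 2) / 2) := by
    rw [← Real.rpow_add hn]
    congr 1
    ring
  have e2 (x : ℝ) : ((n + 1 : ℕ) : ℝ) ^ x = (((n + 1 : ℕ) : ℝ) ^ (x / 2)) ^ 2 := by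
    rw [← Real.rpow_natCast, ← Real.rpow_mul hn.le]
    congr 1
    push_cast
    ring
  calc _ ≤ ‖G‖ * (‖s‖ * ((n + 1 : ℕ) : ℝ) ^ (-s.re - 1)) := by
        rw [norm_mul]
        gcongr
        exact norm_natCast_cpow_neg_sub_le n (by linarith)
    _ ≤ ‖G‖ * (R * ((n + 1 : ℕ) : ℝ) ^ (-σ - 1)) := by gcongr
    _ = R * (‖G‖ * ((n + 1 : ℕ) : ℝ) ^ (-σ - 1)) := by ring
    _ ≤ _ := by
        gcongr
        rw [e1, e2 (-σ - 3 / 2), e2 (-σ - 1 / 2)]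
        nlinarith [sq_nonneg (‖G‖ * ((n + 1 : ℕ) : ℝ) ^ ((-σ - 3 / 2) / 2) -
          ((n + 1 : ℕ) : ℝ) ^ ((-σ - 1 / 2) / 2)),
          sq_nonneg (‖G‖ * ((n + 1 : ℕ) : ℝ) ^ ((-σ - 3 / 2) / 2)),
          sq_nonneg (((n + 1 : ℕ) : ℝ) ^ ((-σ - 1 / 2) / 2))]

/-- A Dirichlet series with bounded coefficients whose partial sums are of square-root size in
quadratic mean extends holomorphically to `1 / 2 < re s`. -/
lemma exists_differentiableOn_eq_tsum {b : ℕ → ℂ} (hb : ∀ i, ‖b i‖ ≤ 1)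
    (hsum : ∀ σ : ℝ, 1 / 2 < σ → Summable fun n : ℕ ↦
      ‖∑ j ∈ Finset.range (n + 1), b j‖ ^ 2 * ((n + 1 : ℕ) : ℝ) ^ (-σ - 3 / 2)) :
    ∃ D : ℂ → ℂ, DifferentiableOn ℂ D {s : ℂ | 1 / 2 < s.re} ∧
      ∀ s : ℂ, 1 < s.re → D s = ∑' i : ℕ, b i * ((i + 1 : ℕ) : ℂ) ^ (-s) := by
  have hmaj (σ : ℝ) (hσ : 1 / 2 < σ) (R : ℝ) : Summable fun n : ℕ ↦
      R * (‖∑ j ∈ Finset.range (n + 1), b j‖ ^ 2 * ((n + 1 : ℕ) : ℝ) ^ (-σ - 3 / 2) +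
        ((n + 1 : ℕ) : ℝ) ^ (-σ - 1 / 2)) :=
    ((hsum σ hσ).add ((summable_nat_add_iff 1).2
      (Real.summable_nat_rpow.2 (by linarith : -σ - 1 / 2 < -1)))).mul_left R
  refine ⟨fun s ↦ ∑' i : ℕ, (∑ j ∈ Finset.range (i + 1), b j) *
      (((i + 1 : ℕ) : ℂ) ^ (-s) - ((i + 2 : ℕ) : ℂ) ^ (-s)), ?_, fun s hs ↦ ?_⟩
  · refine differentiableOn_half_lt_re fun σ hσ R ↦ ?_
    refine Complex.differentiableOn_tsum_of_summable_norm (hmaj σ hσ R) (fun i ↦ ?_)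
      ((isOpen_lt continuous_const Complex.continuous_re).inter
        (isOpen_lt continuous_norm continuous_const))
      fun i s hs ↦ norm_mul_cpow_sub_le hσ _ i hs.1 hs.2
    have hd (k : ℕ) (hk : k ≠ 0) : Differentiable ℂ fun s : ℂ ↦ (k : ℂ) ^ (-s) := fun s ↦
      (differentiableAt_id.neg).const_cpow (Or.inl (Nat.cast_ne_zero.2 hk))
    exact (((hd _ (by simp)).sub (hd _ (by simp))).const_mul _).differentiableOn
  · refine (tsum_mul_cpow_eq_tsum_partialSums hb hs ?_).symm
    exact Summable.of_norm_bounded (hmaj 1 (by norm_num) (‖s‖ + 1))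
      fun i ↦ norm_mul_cpow_sub_le (by norm_num) _ i hs (by simp)

lemma norm_mul_primes_cpow_neg_le {c : Nat.Primes → ℂ} (hc : ∀ p, ‖c p‖ ≤ 1) {σ : ℝ} {s : ℂ}
    (hs : σ ≤ s.re) (p : Nat.Primes) :
    ‖c p * ((p : ℕ) : ℂ) ^ (-s)‖ ≤ ((p : ℕ) : ℝ) ^ (-σ) := by
  rw [norm_mul, Complex.norm_natCast_cpow_of_pos p.2.pos, Complex.neg_re]
  refine (mul_le_of_le_one_left (by positivity) (hc p)).trans ?_
  exact Real.rpow_le_rpow_of_exponent_le (by exact_mod_cast p.2.one_le) (by linarith)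

lemma primes_rpow_neg_le_two_rpow_neg {σ : ℝ} (hσ : 0 < σ) (p : Nat.Primes) :
    ((p : ℕ) : ℝ) ^ (-σ) ≤ 2 ^ (-σ) :=
  Real.rpow_le_rpow_of_nonpos (by norm_num) (by exact_mod_cast p.2.two_le) (by linarith)

lemma norm_mul_primes_cpow_neg_lt_one {c : Nat.Primes → ℂ} (hc : ∀ p, ‖c p‖ ≤ 1) {s : ℂ}
    (hs : 0 < s.re) (p : Nat.Primes) : ‖c p * ((p : ℕ) : ℂ) ^ (-s)‖ < 1 :=
  ((norm_mul_primes_cpow_neg_le hc le_rfl p).trans (primes_rpow_neg_le_two_rpow_neg hs p)).trans_lt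
    (Real.rpow_lt_one_of_one_lt_of_neg (by norm_num) (by linarith))

lemma norm_log_one_sub_inv_sub_self_primes_le {c : Nat.Primes → ℂ} (hc : ∀ p, ‖c p‖ ≤ 1) {σ : ℝ}
    (hσ : 0 < σ) {s : ℂ} (hs : σ ≤ s.re) (p : Nat.Primes) :
    ‖Complex.log (1 - c p * ((p : ℕ) : ℂ) ^ (-s))⁻¹ - c p * ((p : ℕ) : ℂ) ^ (-s)‖ ≤
      ((p : ℕ) : ℝ) ^ (-2 * σ) * ((1 - 2 ^ (-σ))⁻¹ / 2) := by
  have h2 : (2 : ℝ) ^ (-σ) < 1 := Real.rpow_lt_one_of_one_lt_of_neg (by norm_num) (by linarith)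
  have h1 := norm_mul_primes_cpow_neg_le hc hs p
  have h3 := primes_rpow_neg_le_two_rpow_neg hσ p
  have e : ((p : ℕ) : ℝ) ^ (-2 * σ) = (((p : ℕ) : ℝ) ^ (-σ)) ^ 2 := by
    rw [← Real.rpow_natCast, ← Real.rpow_mul (by positivity)]
    congr 1
    push_cast
    ring
  refine (Complex.norm_log_one_sub_inv_sub_self_le ((h1.trans h3).trans_lt h2)).trans ?_
  rw [e, mul_div_assoc]
  have : 0 < 1 - (2 : ℝ) ^ (-σ) := by linarith
  have h5 : 0 < 1 - ‖c p * ((p : ℕ) : ℂ) ^ (-s)‖ := by linarith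
  gcongr
  exact h1.trans h3

lemma summable_log_one_sub_inv_sub_self_primes {c : Nat.Primes → ℂ} (hc : ∀ p, ‖c p‖ ≤ 1) {s : ℂ}
    (hs : 1 / 2 < s.re) : Summable fun p : Nat.Primes ↦
      Complex.log (1 - c p * ((p : ℕ) : ℂ) ^ (-s))⁻¹ - c p * ((p : ℕ) : ℂ) ^ (-s) :=
  Summable.of_norm_bounded
    ((Nat.Primes.summable_rpow.2 (by linarith : -2 * s.re < -1)).mul_right _)
    fun p ↦ norm_log_one_sub_inv_sub_self_primes_le hc (by linarith) le_rfl p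

lemma inv_mem_slitPlane {z : ℂ} (hz : z ∈ Complex.slitPlane) : z⁻¹ ∈ Complex.slitPlane := by
  rw [Complex.mem_slitPlane_iff_arg] at hz ⊢
  rw [Complex.arg_inv, if_neg hz.1]
  refine ⟨fun h ↦ ?_, inv_ne_zero hz.2⟩
  linarith [Complex.neg_pi_lt_arg z]

/-- The quadratic tail of the logarithm of an Euler product with coefficients in the unit disc is
holomorphic on `1 / 2 < re s`. -/
lemma differentiableOn_tsum_log_one_sub_inv_sub_self {c : Nat.Primes → ℂ} (hc : ∀ p, ‖c p‖ ≤ 1) :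
    DifferentiableOn ℂ (fun s ↦ ∑' p : Nat.Primes,
      (Complex.log (1 - c p * ((p : ℕ) : ℂ) ^ (-s))⁻¹ - c p * ((p : ℕ) : ℂ) ^ (-s)))
      {s : ℂ | 1 / 2 < s.re} := by
  refine differentiableOn_half_lt_re fun σ hσ R ↦ DifferentiableOn.mono ?_ fun s hs ↦ hs.1
  refine Complex.differentiableOn_tsum_of_summable_norm
    ((Nat.Primes.summable_rpow.2 (by linarith : -2 * σ < -1)).mul_right _) (fun p s hs ↦ ?_)
    (isOpen_lt continuous_const Complex.continuous_re)
    fun p s hs ↦ norm_log_one_sub_inv_sub_self_primes_le hc (by linarith) (le_of_lt hs) p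
  have hd : DifferentiableAt ℂ (fun s : ℂ ↦ c p * ((p : ℕ) : ℂ) ^ (-s)) s :=
    ((differentiableAt_id.neg).const_cpow (Or.inl (Nat.cast_ne_zero.2 p.2.ne_zero))).const_mul _
  have hmem : 1 - c p * ((p : ℕ) : ℂ) ^ (-s) ∈ Complex.slitPlane := by
    rw [sub_eq_add_neg]
    refine Complex.mem_slitPlane_of_norm_lt_one ?_
    rw [norm_neg]
    exact norm_mul_primes_cpow_neg_lt_one hc (lt_trans (by linarith) (show σ < s.re from hs)) p
  refine DifferentiableAt.differentiableWithinAt (DifferentiableAt.sub ?_ hd)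
  exact ((hd.const_sub 1).inv (Complex.slitPlane_ne_zero hmem)).clog
    (inv_mem_slitPlane hmem)

/-- An Euler product whose linear part extends holomorphically to `1 / 2 < re s` extends to a
nowhere vanishing holomorphic function there. -/
lemma exists_analyticOn_ne_zero_eq_tprod {c : Nat.Primes → ℂ} (hc : ∀ p, ‖c p‖ ≤ 1) {D : ℂ → ℂ}
    (hD : DifferentiableOn ℂ D {s : ℂ | 1 / 2 < s.re})
    (hDc : ∀ s : ℂ, 1 < s.re → D s = ∑' p : Nat.Primes, c p * ((p : ℕ) : ℂ) ^ (-s)) :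
    ∃ F : ℂ → ℂ, AnalyticOn ℂ F {s : ℂ | 1 / 2 < s.re} ∧ (∀ s : ℂ, 1 / 2 < s.re → F s ≠ 0) ∧
      ∀ s : ℂ, 1 < s.re → F s = ∏' p : Nat.Primes, (1 - c p * ((p : ℕ) : ℂ) ^ (-s))⁻¹ := by
  refine ⟨fun s ↦ Complex.exp ((∑' p : Nat.Primes,
    (Complex.log (1 - c p * ((p : ℕ) : ℂ) ^ (-s))⁻¹ - c p * ((p : ℕ) : ℂ) ^ (-s))) + D s),
    ?_, fun s _ ↦ Complex.exp_ne_zero _, fun s hs ↦ ?_⟩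
  · exact ((differentiableOn_tsum_log_one_sub_inv_sub_self hc).add hD).cexp.analyticOn
      (isOpen_lt continuous_const Complex.continuous_re)
  · have h1 : Summable fun p : Nat.Primes ↦ c p * ((p : ℕ) : ℂ) ^ (-s) :=
      Summable.of_norm_bounded (Nat.Primes.summable_rpow.2 (by linarith : -s.re < -1))
        fun p ↦ norm_mul_primes_cpow_neg_le hc le_rfl p
    have h2 := summable_log_one_sub_inv_sub_self_primes hc (s := s) (by linarith)
    have h3 : Summable fun p : Nat.Primes ↦ Complex.log (1 - c p * ((p : ℕ) : ℂ) ^ (-s))⁻¹ := by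
      simpa using h2.add h1
    beta_reduce
    rw [hDc s hs, ← h2.tsum_add h1]
    simp only [sub_add_cancel]
    refine Complex.cexp_tsum_eq_tprod (fun p ↦ inv_ne_zero fun h ↦ ?_) h3
    have := norm_mul_primes_cpow_neg_lt_one hc (s := s) (by linarith) p
    rw [← sub_eq_zero.1 h, norm_one] at this
    exact lt_irrefl _ this

lemma integral_exp_two_pi_I_mul_int (m : ℤ) :
    ∫ θ in (0 : ℝ)..1, Complex.exp (2 * Real.pi * Complex.I * m * θ) = if m = 0 then 1 else 0 := by
  split_ifs with h
  · simp [h]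
  · rw [integral_exp_mul_complex (by simp [h, Real.pi_ne_zero])]
    have : Complex.exp (2 * Real.pi * Complex.I * m) = 1 :=
      Complex.exp_eq_one_iff.2 ⟨m, by ring⟩
    simp [this]

/-- Parseval's identity for trigonometric polynomials. -/
lemma integral_norm_sq_sum_exp (c : ℕ → ℂ) (t : Finset ℕ) :
    ∫ θ in (0 : ℝ)..1, ‖∑ j ∈ t, c j * Complex.exp (2 * Real.pi * Complex.I * θ * j)‖ ^ 2
      = ∑ j ∈ t, ‖c j‖ ^ 2 := by
  have hexpand (θ : ℝ) :
      ((‖∑ j ∈ t, c j * Complex.exp (2 * Real.pi * Complex.I * θ * j)‖ ^ 2 : ℝ) : ℂ) =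
      ∑ j ∈ t, ∑ k ∈ t, c j * (starRingEnd ℂ) (c k) *
        Complex.exp (2 * Real.pi * Complex.I * ((j - k : ℤ) : ℂ) * θ) := by
    rw [Complex.ofReal_pow, ← Complex.mul_conj', map_sum, Finset.sum_mul_sum]
    refine Finset.sum_congr rfl fun j _ ↦ Finset.sum_congr rfl fun k _ ↦ ?_
    rw [map_mul, ← Complex.exp_conj, mul_mul_mul_comm, ← Complex.exp_add]
    congr 2
    simp only [map_mul, Complex.conj_I, Complex.conj_ofReal, map_natCast, map_ofNat]
    push_cast
    ring
  have hint (j k : ℕ) (a : ℂ) : IntervalIntegrable (fun θ : ℝ ↦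
      a * Complex.exp (2 * Real.pi * Complex.I * ((j - k : ℤ) : ℂ) * θ)) volume 0 1 :=
    Continuous.intervalIntegrable (by fun_prop) _ _
  rw [← Complex.ofReal_inj, ← intervalIntegral.integral_ofReal]
  simp only [hexpand]
  rw [intervalIntegral.integral_finsetSum fun j _ ↦
    Continuous.intervalIntegrable (by fun_prop) _ _]
  rw [Complex.ofReal_sum]
  refine Finset.sum_congr rfl fun j hj ↦ ?_
  rw [intervalIntegral.integral_finsetSum fun k _ ↦ hint j k _]
  simp only [intervalIntegral.integral_const_mul, integral_exp_two_pi_I_mul_int, sub_eq_zero,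
    Nat.cast_inj, mul_ite, mul_one, mul_zero]
  rw [Finset.sum_ite_eq, if_pos hj, Complex.mul_conj', Complex.ofReal_pow]

lemma ae_summable_of_integral_le {f : ℕ → ℝ → ℝ} {u : ℕ → ℝ} (hf : ∀ n, Continuous (f n))
    (hf0 : ∀ n θ, 0 ≤ f n θ) (hu : Summable u) (hfu : ∀ n, ∫ θ in (0 : ℝ)..1, f n θ ≤ u n) :
    ∀ᵐ θ ∂(volume.restrict (Set.Icc (0 : ℝ) 1)), Summable fun n ↦ f n θ := by
  have hmeas (n : ℕ) : Measurable fun θ ↦ ENNReal.ofReal (f n θ) :=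
    (hf n).measurable.ennreal_ofReal
  have hle (n : ℕ) : ∫⁻ θ in Set.Icc (0 : ℝ) 1, ENNReal.ofReal (f n θ) ≤ ENNReal.ofReal (u n) := by
    rw [← ofReal_integral_eq_lintegral_ofReal (hf n).continuousOn.integrableOn_Icc
      (ae_of_all _ (hf0 n)), integral_Icc_eq_integral_Ioc,
      ← intervalIntegral.integral_of_le zero_le_one]
    exact ENNReal.ofReal_le_ofReal (hfu n)
  have hfin : ∫⁻ θ in Set.Icc (0 : ℝ) 1, ∑' n, ENNReal.ofReal (f n θ) ≠ ⊤ := by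
    rw [lintegral_tsum fun n ↦ (hmeas n).aemeasurable]
    exact ne_top_of_le_ne_top hu.tsum_ofReal_ne_top (ENNReal.tsum_le_tsum hle)
  filter_upwards [ae_lt_top (Measurable.tsum hmeas) hfin] with θ hθ
  simpa [ENNReal.toReal_ofReal (hf0 _ θ)] using ENNReal.summable_toReal hθ.ne

/-- Partial sums of trigonometric series with bounded coefficients are of square-root size
in quadratic mean, for almost every frequency. -/
lemma ae_summable_norm_sq_partialSums {c : ℕ → ℂ} (hc : ∀ j, ‖c j‖ ≤ 1) {σ : ℝ} (hσ : 1 / 2 < σ) :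
    ∀ᵐ θ : ℝ ∂(volume.restrict (Set.Icc (0 : ℝ) 1)), Summable fun n : ℕ ↦
      ‖∑ j ∈ Finset.range (n + 1),
        c (j + 1) * Complex.exp (2 * Real.pi * Complex.I * θ * (j + 1 : ℕ))‖ ^ 2 *
        ((n + 1 : ℕ) : ℝ) ^ (-σ - 3 / 2) := by
  refine ae_summable_of_integral_le (fun n ↦ by fun_prop) (fun n θ ↦ by positivity)
    ((summable_nat_add_iff 1).2 (Real.summable_nat_rpow.2 (by linarith : -σ - 1 / 2 < -1)))
    fun n ↦ ?_
  have h := integral_norm_sq_sum_exp c ((Finset.range (n + 1)).map (addRightEmbedding 1))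
  simp only [Finset.sum_map, addRightEmbedding_apply] at h
  rw [intervalIntegral.integral_mul_const, h]
  have hle : ∑ j ∈ Finset.range (n + 1), ‖c (j + 1)‖ ^ 2 ≤ ((n + 1 : ℕ) : ℝ) := by
    refine (Finset.sum_le_card_nsmul _ _ 1 fun j _ ↦ ?_).trans (by simp)
    exact pow_le_one₀ (norm_nonneg _) (hc _)
  calc _ ≤ ((n + 1 : ℕ) : ℝ) * ((n + 1 : ℕ) : ℝ) ^ (-σ - 3 / 2) := by gcongr
    _ = ((n + 1 : ℕ) : ℝ) ^ (-σ - 1 / 2) := by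
      rw [mul_comm, ← Real.rpow_add_one (by positivity)]
      congr 1
      ring

lemma tsum_primes_eq_tsum_succ {g : ℕ → ℂ} (hg : Summable fun p : Nat.Primes ↦ g p) :
    ∑' p : Nat.Primes, g p = ∑' i : ℕ, {n : ℕ | n.Prime}.indicator g (i + 1) := by
  have hs : Summable ({n : ℕ | n.Prime}.indicator g) := summable_subtype_iff_indicator.1 hg
  have h := hs.tsum_eq_zero_add
  rw [← tsum_subtype] at h
  rw [Set.indicator_of_notMem (by simp [Nat.not_prime_zero]), zero_add] at h
  exact h

/-- For almost every `θ ∈ [0,1]`, the function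
`f(s,θ) = ∏_p (1 − e^{2πiθp} p^{-s})^{-1}`, initially defined for `Re s > 1`,
has an analytic continuation to `Re s > 1/2` on which it never vanishes. -/
theorem stmt_15 :
    ∀ᵐ θ : ℝ ∂(volume.restrict (Set.Icc (0:ℝ) 1)),
      ∃ F : ℂ → ℂ, AnalyticOn ℂ F {s : ℂ | 1 / 2 < s.re} ∧
        (∀ s : ℂ, 1 / 2 < s.re → F s ≠ 0) ∧
        ∀ s : ℂ, 1 < s.re →
          F s = ∏' p : Nat.Primes,
            (1 - Complex.exp (2 * Real.pi * Complex.I * θ * (p : ℕ)) *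
              ((p : ℕ) : ℂ) ^ (-s))⁻¹ := by
  have hc (j : ℕ) : ‖{n : ℕ | n.Prime}.indicator (1 : ℕ → ℂ) j‖ ≤ 1 := by
    by_cases h : j.Prime <;> simp [h]
  have hσ (m : ℕ) : (1 / 2 : ℝ) < 1 / 2 + 1 / (m + 1) := by
    have : (0 : ℝ) < 1 / (m + 1) := by positivity
    linarith
  filter_upwards [ae_all_iff.2 fun m : ℕ ↦ ae_summable_norm_sq_partialSums hc (hσ m)] with θ hθ
  have hexp (n : ℕ) : ‖Complex.exp (2 * Real.pi * Complex.I * θ * n)‖ = 1 := by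
    have : (2 * Real.pi * Complex.I * θ * n : ℂ) = ((2 * Real.pi * θ * n : ℝ) : ℂ) * Complex.I := by
      push_cast
      ring
    rw [this, Complex.norm_exp_ofReal_mul_I]
  obtain ⟨D, hD, hDs⟩ := exists_differentiableOn_eq_tsum
    (b := fun j ↦ {n : ℕ | n.Prime}.indicator (1 : ℕ → ℂ) (j + 1) *
      Complex.exp (2 * Real.pi * Complex.I * θ * (j + 1 : ℕ)))
    (fun i ↦ by rw [norm_mul, hexp, mul_one]; exact hc _) (fun σ hσ ↦ by
      obtain ⟨m, hm⟩ := exists_nat_one_div_lt (sub_pos.2 hσ)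
      refine (hθ m).of_nonneg_of_le (fun n ↦ by positivity) fun n ↦ ?_
      gcongr
      · simp
      · linarith)
  refine exists_analyticOn_ne_zero_eq_tprod (fun p ↦ (hexp p).le) hD fun s hs ↦ ?_
  have hsum : Summable fun p : Nat.Primes ↦
      Complex.exp (2 * Real.pi * Complex.I * θ * (p : ℕ)) * ((p : ℕ) : ℂ) ^ (-s) :=
    Summable.of_norm_bounded (Nat.Primes.summable_rpow.2 (by linarith : -s.re < -1))
      fun p ↦ norm_mul_primes_cpow_neg_le
        (c := fun p ↦ Complex.exp (2 * Real.pi * Complex.I * θ * (p : ℕ)))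
        (fun p ↦ (hexp p).le) le_rfl p
  rw [hDs s hs, tsum_primes_eq_tsum_succ
    (g := fun n ↦ Complex.exp (2 * Real.pi * Complex.I * θ * n) * (n : ℂ) ^ (-s)) hsum]
  refine tsum_congr fun i ↦ ?_
  by_cases h : (i + 1).Prime <;> simp [h]
end
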